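/- Let k ∈ ℕ ∪ {0}, 0 < γ < 1, and u ∈ C^{k,γ}(S¹). Then ‖e^{tΛ}u − u‖_{C^{k,γ}} → 0 as t ↓ 0 if and only if u belongs to the little Hölder space h^{k,γ}(S¹). -/

import Mathlib

open Real MeasureTheory Filter Set
open scoped Classical

noncomputable section

/-- The plane `ℝ²` with the Euclidean norm. -/
abbrev R2 : Type := EuclideanSpace ℝ (Fin 2)

variable {E : Type*} [NormedAddCommGroup E] [NormedSpace ℝ E]

/-- Sup norm of a function on the circle (functions on the circle are
`2π`-periodic functions on `ℝ`). -/
def supN (u : ℝ → E) : ℝ := sSup {r : ℝ | ∃ θ : ℝ, r = ‖u θ‖}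

/-- The `C^k` norm `‖u‖_{C^k} = ∑_{l ≤ k} sup |∂^l u|`. -/
def CkN (k : ℕ) (u : ℝ → E) : ℝ :=
  ∑ l ∈ Finset.range (k + 1), supN (iteratedDeriv l u)

/-- The Hölder seminorm `[u]_γ` (since `1 < π`, the constraint `0 < |θ - θ'| < 1`
realizes the distance on the circle by the real distance of representatives). -/
def hoSemi (γ : ℝ) (u : ℝ → E) : ℝ :=
  sSup {r : ℝ | ∃ θ θ' : ℝ, 0 < |θ - θ'| ∧ |θ - θ'| < 1 ∧
    r = ‖u θ - u θ'‖ / |θ - θ'| ^ γ}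

/-- The `C^{0,γ}` norm. -/
def C0γN (γ : ℝ) (u : ℝ → E) : ℝ := supN u + hoSemi γ u

/-- The `C^{k,γ}` norm. -/
def CkγN (k : ℕ) (γ : ℝ) (u : ℝ → E) : ℝ := CkN k u + hoSemi γ (iteratedDeriv k u)

/-- `⟨u⟩_{1,γ} := ‖∂_θ u‖_{C^{0,γ}}`. -/
def lil (γ : ℝ) (u : ℝ → E) : ℝ := C0γN γ (deriv u)

/-- `|X|_⋆ = inf_{θ ≠ θ'} ‖X θ - X θ'‖ / |θ - θ'|`, the infimum being taken over
representatives with `|θ - θ'| ≤ π`, so that `|θ - θ'|` is the circle distance. -/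
def starN (X : ℝ → E) : ℝ :=
  sInf {r : ℝ | ∃ θ θ' : ℝ, 0 < |θ - θ'| ∧ |θ - θ'| ≤ Real.pi ∧
    r = ‖X θ - X θ'‖ / |θ - θ'|}

/-- Membership in the Hölder space `C^{k,γ}(S¹)`. -/
def MemHo (k : ℕ) (γ : ℝ) (u : ℝ → E) : Prop :=
  Function.Periodic u (2 * Real.pi) ∧ ContDiff ℝ k u ∧
  ∃ C : ℝ, ∀ θ θ' : ℝ, 0 < |θ - θ'| → |θ - θ'| < 1 →
    ‖iteratedDeriv k u θ - iteratedDeriv k u θ'‖ ≤ C * |θ - θ'| ^ γ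

/-- Membership in the little Hölder space `h^{k,γ}(S¹)`. -/
def MemLittle (k : ℕ) (γ : ℝ) (u : ℝ → E) : Prop :=
  MemHo k γ u ∧
  ∀ ε : ℝ, 0 < ε → ∃ δ : ℝ, 0 < δ ∧ ∀ θ θ' : ℝ, 0 < |θ - θ'| → |θ - θ'| < δ →
    ‖iteratedDeriv k u θ - iteratedDeriv k u θ'‖ ≤ ε * |θ - θ'| ^ γ

/-- Partial derivative in the first variable, `∂_θ f`. -/
def pd1 (f : ℝ → ℝ → E) (θ θ' : ℝ) : E := deriv (fun s => f s θ') θ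

/-- Partial derivative in the second variable, `∂_{θ'} f`. -/
def pd2 (f : ℝ → ℝ → E) (θ θ' : ℝ) : E := deriv (fun t => f θ t) θ'

/-- `∂_{θ'} ∂_θ f`. -/
def pd21 (f : ℝ → ℝ → E) (θ θ' : ℝ) : E :=
  deriv (fun t => deriv (fun s => f s t) θ) θ'

/-- `∂_θ ∂_{θ'} f`. -/
def pd12 (f : ℝ → ℝ → E) (θ θ' : ℝ) : E :=
  deriv (fun s => deriv (fun t => f s t) θ') θ

/-- Finite difference in the first variable, `(Δ_h f)(θ,θ') = f(θ+h,θ') - f(θ,θ')`. -/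
def dh (h : ℝ) (f : ℝ → ℝ → E) (θ θ' : ℝ) : E := f (θ + h) θ' - f θ θ'

/-- The Poisson kernel `P(r,θ)`. -/
def poisson (r θ : ℝ) : ℝ := (1 - r ^ 2) / (1 - 2 * r * Real.cos θ + r ^ 2)

/-- The semigroup `e^{tΛ}`, given by convolution with the Poisson kernel at
`r = e^{-t/4}`; it acts componentwise on vector-valued functions. -/
def heatOp (t : ℝ) (u : ℝ → E) : ℝ → E :=
  fun θ => (1 / (2 * Real.pi)) •
    ∫ θ' in (0 : ℝ)..(2 * Real.pi), poisson (Real.exp (-t / 4)) (θ - θ') • u θ'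

/-- Dot product on `ℝ²`. -/
def dot2 (v w : R2) : ℝ := v 0 * w 0 + v 1 * w 1

/-- Construct an element of `ℝ²`. -/
def mk2 (a b : ℝ) : R2 := (WithLp.equiv 2 (Fin 2 → ℝ)).symm ![a, b]

/-- The scalar kernel `K_C(θ,θ') = (ΔX · ∂_{θ'}X')/|ΔX|² - (1/2)cot((θ-θ')/2)`. -/
def KC (X : ℝ → R2) (θ θ' : ℝ) : ℝ :=
  dot2 (X θ - X θ') (deriv X θ') / ‖X θ - X θ'‖ ^ 2
    - (1 / 2) * (Real.cos ((θ - θ') / 2) / Real.sin ((θ - θ') / 2))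

/-- `F_C[u](θ) = -(1/4π) ∫ K_C(θ,θ') u(θ') dθ'`. -/
def FC (X : ℝ → R2) (u : ℝ → R2) : ℝ → R2 :=
  fun θ => (-(1 / (4 * Real.pi))) •
    ∫ θ' in (0 : ℝ)..(2 * Real.pi), KC X θ θ' • u θ'

/-- Entries of the matrix kernel `K_T(θ,θ') = ∂_{θ'}((ΔX ⊗ ΔX)/|ΔX|²)`. -/
def KT (X : ℝ → R2) (i j : Fin 2) (θ θ' : ℝ) : ℝ :=
  deriv (fun t => (X θ i - X t i) * (X θ j - X t j) / ‖X θ - X t‖ ^ 2) θ'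

/-- `F_T[u](θ) = -(1/4π) ∫ K_T(θ,θ') u(θ') dθ'`. -/
def FT (X : ℝ → R2) (u : ℝ → R2) : ℝ → R2 :=
  fun θ => (-(1 / (4 * Real.pi))) •
    ∫ θ' in (0 : ℝ)..(2 * Real.pi),
      mk2 (KT X 0 0 θ θ' * u θ' 0 + KT X 0 1 θ θ' * u θ' 1)
          (KT X 1 0 θ θ' * u θ' 0 + KT X 1 1 θ θ' * u θ' 1)

/-- The nonlinear remainder `R(X) = F_C[∂_θ X] + F_T[∂_θ X]`. -/
def RR (X : ℝ → R2) : ℝ → R2 := fun θ => FC X (deriv X) θ + FT X (deriv X) θ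

/-- The `C^α` norm for a real exponent `α ≥ 0`:
`C^α = C^{⌊α⌋, α - ⌊α⌋}` for non-integer `α`, and `C^k` for `α = k ∈ ℤ`. -/
def CAnorm (α : ℝ) (u : ℝ → E) : ℝ :=
  if α = (⌊α⌋ : ℝ) then CkN ⌊α⌋.toNat u else CkγN ⌊α⌋.toNat (α - ⌊α⌋) u

/-- Membership in `C^α(S¹)` for a real exponent `α ≥ 0`. -/
def MemCA (α : ℝ) (u : ℝ → E) : Prop :=
  Function.Periodic u (2 * Real.pi) ∧ ContDiff ℝ (⌊α⌋.toNat) u ∧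
  (α = (⌊α⌋ : ℝ) ∨
    ∃ C : ℝ, ∀ θ θ' : ℝ, 0 < |θ - θ'| → |θ - θ'| < 1 →
      ‖iteratedDeriv ⌊α⌋.toNat u θ - iteratedDeriv ⌊α⌋.toNat u θ'‖ ≤
        C * |θ - θ'| ^ (α - ⌊α⌋))

/-- A mild solution of the Peskin problem on `[0,T]` with initial value `X₀`. -/
def IsMildSolution (γ T : ℝ) (X₀ : ℝ → R2) (X : ℝ → ℝ → R2) : Prop :=
  (∀ t ∈ Set.Icc (0 : ℝ) T, MemHo 1 γ (X t)) ∧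
  (∀ t ∈ Set.Icc (0 : ℝ) T, 0 < starN (X t)) ∧
  (∀ t ∈ Set.Icc (0 : ℝ) T, ∀ ε : ℝ, 0 < ε → ∃ δ : ℝ, 0 < δ ∧
      ∀ s ∈ Set.Icc (0 : ℝ) T, |s - t| < δ →
        CkγN 1 γ (fun θ => X s θ - X t θ) < ε) ∧
  (∀ t : ℝ, 0 < t → t ≤ T → ∀ θ : ℝ,
      X t θ = heatOp t X₀ θ + ∫ s in (0 : ℝ)..t, heatOp (t - s) (RR (X s)) θ) ∧
  (∀ ε : ℝ, 0 < ε → ∃ δ : ℝ, 0 < δ ∧ ∀ t : ℝ, 0 < t → t < δ →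
      CkγN 1 γ (fun θ => X t θ - X₀ θ) < ε)

/-- `e_r(θ) = (cos θ, sin θ)`. -/
def eRad : ℝ → R2 := fun θ => mk2 (Real.cos θ) (Real.sin θ)
/-- `e_t(θ) = (-sin θ, cos θ)`. -/
def eTan : ℝ → R2 := fun θ => mk2 (-Real.sin θ) (Real.cos θ)
/-- `e_x = (1,0)`. -/
def eXv : ℝ → R2 := fun _ => mk2 1 0
/-- `e_y = (0,1)`. -/
def eYv : ℝ → R2 := fun _ => mk2 0 1

/-- The `L²` pairing `⟨v,w⟩ = ∫_{S¹} v·w dθ`. -/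
def ip (v w : ℝ → R2) : ℝ := ∫ θ in (0 : ℝ)..(2 * Real.pi), dot2 (v θ) (w θ)

/-- Coefficient of `e_r` in the `L²` projection. -/
def coefR (X : ℝ → R2) : ℝ := (1 / (2 * Real.pi)) * ip X eRad
/-- Coefficient of `e_t` in the `L²` projection. -/
def coefT (X : ℝ → R2) : ℝ := (1 / (2 * Real.pi)) * ip X eTan
/-- Coefficient of `e_x` in the `L²` projection. -/
def coefX (X : ℝ → R2) : ℝ := (1 / (2 * Real.pi)) * ip X eXv
/-- Coefficient of `e_y` in the `L²` projection. -/
def coefY (X : ℝ → R2) : ℝ := (1 / (2 * Real.pi)) * ip X eYv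

/-- The projection `P` onto `span{e_r, e_t, e_x, e_y}`. -/
def projP (X : ℝ → R2) : ℝ → R2 := fun θ =>
  coefR X • eRad θ + coefT X • eTan θ + coefX X • eXv θ + coefY X • eYv θ

/-- The complementary projection `Π`. -/
def projPi (X : ℝ → R2) : ℝ → R2 := fun θ => X θ - projP X θ

/-- The `α`-deformation ratio `ϱ_α(X) = ‖∂_θ X‖_{C^{0,α}} / |X|_⋆`. -/
def defRatio (α : ℝ) (X : ℝ → R2) : ℝ := C0γN α (deriv X) / starN X

end

/-- The average of `f` over `[-π, π]` weighted by the Poisson kernel. -/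
noncomputable def poissonAvg (r : ℝ) (f : ℝ → ℝ) : ℝ :=
  (1 / (2 * Real.pi)) * ∫ s in (-Real.pi)..Real.pi, poisson r s * f s

section PoissonKernel

variable {r : ℝ}

lemma sq_one_sub_le_poisson_denom (hr : 0 < r) (s : ℝ) :
    (1 - r) ^ 2 ≤ 1 - 2 * r * Real.cos s + r ^ 2 := by
  nlinarith [Real.cos_le_one s]

lemma poisson_denom_pos (hr : 0 < r) (hr1 : r < 1) (s : ℝ) :
    0 < 1 - 2 * r * Real.cos s + r ^ 2 :=
  lt_of_lt_of_le (pow_pos (by linarith) 2) (sq_one_sub_le_poisson_denom hr s)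

lemma poisson_nonneg (hr : 0 < r) (hr1 : r < 1) (s : ℝ) : 0 ≤ poisson r s :=
  div_nonneg (by nlinarith) (poisson_denom_pos hr hr1 s).le

lemma continuous_poisson (hr : 0 < r) (hr1 : r < 1) : Continuous (poisson r) := by
  unfold poisson
  exact continuous_const.div (by fun_prop) fun s => (poisson_denom_pos hr hr1 s).ne'

lemma periodic_poisson (r : ℝ) : Function.Periodic (poisson r) (2 * Real.pi) := fun s => by
  simp [poisson]

lemma abs_poisson_sub_le (hr : 0 < r) (hr1 : r < 1) (a b : ℝ) :
    |poisson r a - poisson r b| ≤ (1 - r ^ 2) * (2 * r) / (1 - r) ^ 4 * |a - b| := by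
  have ha := poisson_denom_pos hr hr1 a
  have hb := poisson_denom_pos hr hr1 b
  have h1 : 0 < 1 - r := by linarith
  have h2 : 0 ≤ 1 - r ^ 2 := by nlinarith
  have key : poisson r a - poisson r b = (1 - r ^ 2) * (2 * r) * (Real.cos a - Real.cos b) /
      ((1 - 2 * r * Real.cos a + r ^ 2) * (1 - 2 * r * Real.cos b + r ^ 2)) := by
    unfold poisson
    rw [div_sub_div _ _ ha.ne' hb.ne']
    congr 1
    ring
  rw [key, abs_div, abs_mul, abs_of_pos (mul_pos ha hb),
    abs_of_nonneg (mul_nonneg h2 (by linarith)), div_mul_eq_mul_div]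
  have h4 : (1 - r) ^ 4 ≤ (1 - 2 * r * Real.cos a + r ^ 2) * (1 - 2 * r * Real.cos b + r ^ 2) := by
    calc (1 - r) ^ 4 = (1 - r) ^ 2 * (1 - r) ^ 2 := by ring
      _ ≤ _ := by
        gcongr
        exacts [sq_one_sub_le_poisson_denom hr a, sq_one_sub_le_poisson_denom hr b]
  have h5 := Real.abs_cos_sub_cos_le a b
  gcongr

lemma poisson_mul_one_sub_cos_le (hr : 0 < r) (hr1 : r < 1) (s : ℝ) :
    poisson r s * (1 - Real.cos s) ≤ (1 - r ^ 2) / (2 * r) := by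
  have hs := poisson_denom_pos hr hr1 s
  have h2 : 0 ≤ 1 - r ^ 2 := by nlinarith
  rw [poisson, div_mul_eq_mul_div, div_le_div_iff₀ hs (by positivity), mul_assoc]
  gcongr
  nlinarith [sq_nonneg (1 - r)]

lemma integral_poisson (hr : 0 < r) (hr1 : r < 1) :
    ∫ s in (-Real.pi)..Real.pi, poisson r s = 2 * Real.pi := by
  have h := DiffContOnCl.circleAverage_poissonKernel_smul' (f := fun _ => (1 : ℂ)) (c := 0)
    (R := 1) (w := (r : ℂ)) diffContOnCl_const (by simp [abs_of_pos hr, hr1])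
  have hker : ∀ θ : ℝ, (‖circleMap 0 1 θ - 0‖ ^ 2 - ‖(r : ℂ) - 0‖ ^ 2) /
      ‖(circleMap 0 1 θ - 0) - ((r : ℂ) - 0)‖ ^ 2 = poisson r θ := by
    intro θ
    have hsq : ‖circleMap 0 1 θ - r‖ ^ 2 = 1 - 2 * r * Real.cos θ + r ^ 2 := by
      rw [← Complex.normSq_eq_norm_sq, Complex.normSq_apply]
      simp only [Complex.sub_re, Complex.sub_im, circleMap_zero_re, circleMap_zero_im,
        Complex.ofReal_re, Complex.ofReal_im]
      linear_combination Real.sin_sq_add_cos_sq θ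
    simp [hsq, poisson]
  simp only [Real.circleAverage_def, hker, Complex.real_smul, mul_one] at h
  rw [intervalIntegral.integral_ofReal] at h
  have hper := (periodic_poisson r).intervalIntegral_add_eq (-Real.pi) 0
  rw [show -Real.pi + 2 * Real.pi = Real.pi by ring, zero_add] at hper
  rw [hper]
  have h' : (2 * Real.pi)⁻¹ * ∫ θ in (0 : ℝ)..2 * Real.pi, poisson r θ = 1 := by
    exact_mod_cast h
  field_simp at h'
  linarith

lemma poissonAvg_const (hr : 0 < r) (hr1 : r < 1) (c : ℝ) : poissonAvg r (fun _ => c) = c := by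
  rw [poissonAvg, intervalIntegral.integral_mul_const, integral_poisson hr hr1]
  field_simp

lemma intervalIntegrable_poisson_mul (hr : 0 < r) (hr1 : r < 1) {f : ℝ → ℝ} (hf : Continuous f)
    (a b : ℝ) : IntervalIntegrable (fun s => poisson r s * f s) volume a b :=
  ((continuous_poisson hr hr1).mul hf).intervalIntegrable a b

lemma poissonAvg_sub (hr : 0 < r) (hr1 : r < 1) {f g : ℝ → ℝ} (hf : Continuous f)
    (hg : Continuous g) :
    poissonAvg r f - poissonAvg r g = poissonAvg r (fun s => f s - g s) := by
  unfold poissonAvg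
  rw [← mul_sub, ← intervalIntegral.integral_sub (intervalIntegrable_poisson_mul hr hr1 hf _ _)
    (intervalIntegrable_poisson_mul hr hr1 hg _ _)]
  simp only [mul_sub]

lemma poissonAvg_add (hr : 0 < r) (hr1 : r < 1) {f g : ℝ → ℝ} (hf : Continuous f)
    (hg : Continuous g) :
    poissonAvg r (fun s => f s + g s) = poissonAvg r f + poissonAvg r g := by
  unfold poissonAvg
  rw [← mul_add, ← intervalIntegral.integral_add (intervalIntegrable_poisson_mul hr hr1 hf _ _)
    (intervalIntegrable_poisson_mul hr hr1 hg _ _)]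
  simp only [mul_add]

lemma abs_poissonAvg_le (hr : 0 < r) (hr1 : r < 1) {f g : ℝ → ℝ} (hg : Continuous g)
    (h : ∀ s, |s| ≤ Real.pi → |f s| ≤ g s) : |poissonAvg r f| ≤ poissonAvg r g := by
  have hπ := Real.pi_pos
  unfold poissonAvg
  rw [abs_mul, abs_of_pos (by positivity)]
  gcongr
  rw [← Real.norm_eq_abs]
  refine intervalIntegral.norm_integral_le_of_norm_le (by linarith)
    (.of_forall fun s hs => ?_) (intervalIntegrable_poisson_mul hr hr1 hg _ _)
  rw [Real.norm_eq_abs, abs_mul, abs_of_nonneg (poisson_nonneg hr hr1 s)]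
  exact mul_le_mul_of_nonneg_left (h s (abs_le.2 ⟨hs.1.le, hs.2⟩)) (poisson_nonneg hr hr1 s)

lemma poissonAvg_one_sub_cos_le (hr : 0 < r) (hr1 : r < 1) :
    poissonAvg r (fun s => 1 - Real.cos s) ≤ (1 - r ^ 2) / (2 * r) := by
  have hπ := Real.pi_pos
  have h : ∫ s in (-Real.pi)..Real.pi, poisson r s * (1 - Real.cos s) ≤
      ∫ _s in (-Real.pi)..Real.pi, (1 - r ^ 2) / (2 * r) :=
    intervalIntegral.integral_mono_on (by linarith)
      (intervalIntegrable_poisson_mul hr hr1 (by fun_prop) _ _) (by simp)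
      fun s _ => poisson_mul_one_sub_cos_le hr hr1 s
  rw [intervalIntegral.integral_const, smul_eq_mul] at h
  calc poissonAvg r (fun s => 1 - Real.cos s)
      ≤ 1 / (2 * Real.pi) * ((Real.pi - -Real.pi) * ((1 - r ^ 2) / (2 * r))) := by
        unfold poissonAvg
        gcongr
    _ = _ := by field_simp; ring

end PoissonKernel

section PeriodicFunctions

variable {w : ℝ → ℝ}

lemma Function.Periodic.exists_abs_le (hp : Function.Periodic w (2 * Real.pi))
    (hw : Continuous w) : ∃ M, 0 < M ∧ ∀ θ, |w θ| ≤ M := by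
  obtain ⟨M, hM, h⟩ := (hp.isBounded_of_continuous (by positivity) hw).exists_pos_norm_le
  exact ⟨M, hM, fun θ => h _ ⟨θ, rfl⟩⟩

lemma Function.Periodic.exists_abs_sub_lt (hp : Function.Periodic w (2 * Real.pi))
    (hw : Continuous w) {ε : ℝ} (hε : 0 < ε) :
    ∃ δ, 0 < δ ∧ ∀ θ s, |s| < δ → |w (θ - s) - w θ| < ε := by
  have hu := (isCompact_Icc (a := (-1 : ℝ)) (b := 2 * Real.pi + 1)).uniformContinuousOn_of_continuous
    hw.continuousOn
  obtain ⟨δ, hδ, h⟩ := Metric.uniformContinuousOn_iff.1 hu ε hε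
  refine ⟨min δ 1, by positivity, fun θ s hs => ?_⟩
  have hg : Function.Periodic (fun θ s => w (θ - s)) (2 * Real.pi) := fun θ => by
    funext s
    simpa [add_sub_right_comm] using hp (θ - s)
  obtain ⟨y, hy, hθ⟩ := hg.exists_mem_Ico₀ (by positivity) θ
  have h1 : w (θ - s) = w (y - s) := congrFun hθ s
  have h2 : w θ = w y := by simpa using congrFun hθ 0
  obtain ⟨hs1, hs2⟩ := lt_min_iff.1 hs
  obtain ⟨hs3, hs4⟩ := abs_lt.1 hs2
  rw [h1, h2]
  exact h _ ⟨by linarith [hy.1], by linarith [hy.2]⟩ _ ⟨by linarith [hy.1], by linarith [hy.2]⟩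
    (by simpa [Real.dist_eq] using hs1)

lemma Function.Periodic.iteratedDeriv {c : ℝ} (hp : Function.Periodic w c) (n : ℕ) :
    Function.Periodic (iteratedDeriv n w) c := fun θ => by
  rw [← congrFun (iteratedDeriv_comp_add_const n w c) θ]
  exact congrArg (fun f => _root_.iteratedDeriv n f θ) (funext hp)

end PeriodicFunctions

section HeatOp

variable {t : ℝ} {w : ℝ → ℝ}

lemma exp_neg_div_four_lt_one (ht : 0 < t) : Real.exp (-t / 4) < 1 :=
  Real.exp_lt_one_iff.2 (by linarith)

lemma heatOp_eq_poissonAvg (hp : Function.Periodic w (2 * Real.pi)) (t θ : ℝ) :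
    heatOp t w θ = poissonAvg (Real.exp (-t / 4)) (fun s => w (θ - s)) := by
  unfold heatOp poissonAvg
  rw [smul_eq_mul]
  congr 1
  have h1 := intervalIntegral.integral_comp_sub_left (a := 0) (b := 2 * Real.pi)
    (fun s => poisson (Real.exp (-t / 4)) s * w (θ - s)) θ
  have h2 : Function.Periodic (fun s => poisson (Real.exp (-t / 4)) s * w (θ - s))
      (2 * Real.pi) := (periodic_poisson _).mul (hp.const_sub θ)
  have h3 := h2.intervalIntegral_add_eq (θ - 2 * Real.pi) (-Real.pi)
  rw [show θ - 2 * Real.pi + 2 * Real.pi = θ - 0 by ring,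
    show -Real.pi + 2 * Real.pi = Real.pi by ring] at h3
  rw [← h3, ← h1]
  simp

lemma hasDerivAt_heatOp (ht : 0 < t) (hp : Function.Periodic w (2 * Real.pi))
    (hd : Differentiable ℝ w) (hc : Continuous (deriv w)) (θ : ℝ) :
    HasDerivAt (heatOp t w) (heatOp t (deriv w) θ) θ := by
  have hr := Real.exp_pos (-t / 4)
  have hr1 := exp_neg_div_four_lt_one ht
  have hp' : Function.Periodic (deriv w) (2 * Real.pi) := by
    simpa using hp.iteratedDeriv 1
  obtain ⟨M, hM, hb⟩ := hp'.exists_abs_le hc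
  have hP := continuous_poisson hr hr1
  have hwc := hd.continuous
  rw [funext (heatOp_eq_poissonAvg hp t), heatOp_eq_poissonAvg hp']
  unfold poissonAvg
  refine HasDerivAt.const_mul _ (intervalIntegral.hasDerivAt_integral_of_dominated_loc_of_deriv_le
    (F := fun x s => poisson (Real.exp (-t / 4)) s * w (x - s))
    (F' := fun x s => poisson (Real.exp (-t / 4)) s * deriv w (x - s))
    (bound := fun s => poisson (Real.exp (-t / 4)) s * M) univ_mem
    (.of_forall fun x => Continuous.aestronglyMeasurable (by fun_prop))
    (Continuous.intervalIntegrable (by fun_prop) _ _)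
    (Continuous.aestronglyMeasurable (by fun_prop))
    (.of_forall fun s _ x _ => ?_) (Continuous.intervalIntegrable (by fun_prop) _ _)
    (.of_forall fun s _ x _ => ?_)).2
  · rw [Real.norm_eq_abs, abs_mul, abs_of_nonneg (poisson_nonneg hr hr1 s)]
    exact mul_le_mul_of_nonneg_left (hb _) (poisson_nonneg hr hr1 s)
  · simpa using ((hd (x - s)).hasDerivAt.comp_sub_const x s).const_mul
      (poisson (Real.exp (-t / 4)) s)

lemma iteratedDeriv_heatOp_sub {k : ℕ} (ht : 0 < t) (hp : Function.Periodic w (2 * Real.pi))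
    (hw : ContDiff ℝ k w) {l : ℕ} (hl : l ≤ k) :
    iteratedDeriv l (fun θ => heatOp t w θ - w θ) =
      fun θ => heatOp t (iteratedDeriv l w) θ - iteratedDeriv l w θ := by
  induction l with
  | zero => simp
  | succ l ih =>
    have hd : Differentiable ℝ (iteratedDeriv l w) :=
      hw.differentiable_iteratedDeriv l (by exact_mod_cast hl)
    have hc : Continuous (deriv (iteratedDeriv l w)) := by
      rw [← iteratedDeriv_succ]
      exact hw.continuous_iteratedDeriv _ (by exact_mod_cast hl)
    rw [iteratedDeriv_succ, ih (by omega), iteratedDeriv_succ]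
    funext θ
    exact ((hasDerivAt_heatOp ht (hp.iteratedDeriv l) hd hc θ).sub (hd θ).hasDerivAt).deriv

/-- The Poisson semigroup does not increase the modulus of continuity. -/
lemma abs_heatOp_sub_heatOp_le (ht : 0 < t) (hp : Function.Periodic w (2 * Real.pi))
    (hw : Continuous w) {θ θ' C : ℝ} (h : ∀ s, |w (θ - s) - w (θ' - s)| ≤ C) :
    |heatOp t w θ - heatOp t w θ'| ≤ C := by
  have hr := Real.exp_pos (-t / 4)
  have hr1 := exp_neg_div_four_lt_one ht
  rw [heatOp_eq_poissonAvg hp, heatOp_eq_poissonAvg hp,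
    poissonAvg_sub hr hr1 (by fun_prop) (by fun_prop)]
  exact (abs_poissonAvg_le hr hr1 continuous_const fun s _ => h s).trans_eq
    (poissonAvg_const hr hr1 C)

lemma exists_lipschitz_heatOp (ht : 0 < t) (hp : Function.Periodic w (2 * Real.pi))
    (hw : Continuous w) :
    ∃ L, 0 < L ∧ ∀ θ θ', |heatOp t w θ - heatOp t w θ'| ≤ L * |θ - θ'| := by
  have hr := Real.exp_pos (-t / 4)
  have hr1 := exp_neg_div_four_lt_one ht
  set r := Real.exp (-t / 4) with hrdef
  have hP := continuous_poisson hr hr1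
  obtain ⟨M, hM, hb⟩ := hp.exists_abs_le hw
  have hK : 0 < (1 - r ^ 2) * (2 * r) / (1 - r) ^ 4 := by
    have : 0 < 1 - r := by linarith
    have : 0 < 1 - r ^ 2 := by nlinarith
    positivity
  refine ⟨(1 - r ^ 2) * (2 * r) / (1 - r) ^ 4 * M, by positivity, fun θ θ' => ?_⟩
  have hint : ∀ x, IntervalIntegrable (fun y => poisson r (x - y) * w y) volume 0
      (2 * Real.pi) := fun x => Continuous.intervalIntegrable (by fun_prop) _ _
  have hle := intervalIntegral.norm_integral_le_of_norm_le_const (a := 0) (b := 2 * Real.pi)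
    (f := fun y => poisson r (θ - y) * w y - poisson r (θ' - y) * w y)
    (C := (1 - r ^ 2) * (2 * r) / (1 - r) ^ 4 * |θ - θ'| * M) fun y _ => by
      rw [← sub_mul, Real.norm_eq_abs, abs_mul]
      have := abs_poisson_sub_le hr hr1 (θ - y) (θ' - y)
      rw [sub_sub_sub_cancel_right] at this
      gcongr
      exact hb y
  rw [intervalIntegral.integral_sub (hint θ) (hint θ'), sub_zero, Real.norm_eq_abs,
    abs_of_pos Real.two_pi_pos] at hle
  simp only [heatOp, smul_eq_mul, ← hrdef]
  rw [← mul_sub, abs_mul, abs_of_pos (by positivity), one_div, inv_mul_le_iff₀ (by positivity)]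
  linarith

/-- The Poisson semigroup is strongly continuous in the sup norm. -/
lemma eventually_abs_heatOp_sub_le (hp : Function.Periodic w (2 * Real.pi)) (hw : Continuous w)
    {ε : ℝ} (hε : 0 < ε) :
    ∀ᶠ t in nhdsWithin (0 : ℝ) (Set.Ioi 0), ∀ θ, |heatOp t w θ - w θ| ≤ ε := by
  obtain ⟨δ, hδ, hcont⟩ := hp.exists_abs_sub_lt hw (half_pos hε)
  obtain ⟨M, hM, hb⟩ := hp.exists_abs_le hw
  have hπ := Real.pi_pos
  set A : ℝ := M * Real.pi ^ 2 / δ ^ 2 with hA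
  have hA0 : 0 < A := by positivity
  have hpt : ∀ θ s, |s| ≤ Real.pi → |w (θ - s) - w θ| ≤ ε / 2 + A * (1 - Real.cos s) := by
    intro θ s hs
    rcases lt_or_ge |s| δ with h | h
    · have := mul_nonneg hA0.le (sub_nonneg.2 (Real.cos_le_one s))
      linarith [hcont θ s h]
    · have h1 : 2 / Real.pi ^ 2 * δ ^ 2 ≤ 1 - Real.cos s := by
        have h2 : δ ^ 2 ≤ s ^ 2 := by rw [← sq_abs s]; gcongr
        have h3 : 2 / Real.pi ^ 2 * δ ^ 2 ≤ 2 / Real.pi ^ 2 * s ^ 2 := by gcongr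
        linarith [Real.cos_le_one_sub_mul_cos_sq hs]
      have h2 : A * (2 / Real.pi ^ 2 * δ ^ 2) = 2 * M := by
        rw [hA]
        field_simp
      have h3 := mul_le_mul_of_nonneg_left h1 hA0.le
      linarith [abs_sub (w (θ - s)) (w θ), hb (θ - s), hb θ]
  have hlim : Tendsto (fun t : ℝ => A * ((1 - Real.exp (-t / 4) ^ 2) / (2 * Real.exp (-t / 4))))
      (nhdsWithin 0 (Set.Ioi 0)) (nhds 0) := by
    have hc : Continuous fun t : ℝ =>
        A * ((1 - Real.exp (-t / 4) ^ 2) / (2 * Real.exp (-t / 4))) :=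
      continuous_const.mul (Continuous.div (by fun_prop) (by fun_prop) fun t => by positivity)
    simpa using (hc.tendsto 0).mono_left nhdsWithin_le_nhds
  filter_upwards [hlim.eventually (gt_mem_nhds (half_pos hε)), self_mem_nhdsWithin] with t ht ht0 θ
  have hr := Real.exp_pos (-t / 4)
  have hr1 := exp_neg_div_four_lt_one ht0
  have hA1 : poissonAvg (Real.exp (-t / 4)) (fun s => A * (1 - Real.cos s)) =
      A * poissonAvg (Real.exp (-t / 4)) (fun s => 1 - Real.cos s) := by
    simp only [poissonAvg, mul_left_comm _ A, intervalIntegral.integral_const_mul]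
  calc |heatOp t w θ - w θ|
      = |poissonAvg (Real.exp (-t / 4)) (fun s => w (θ - s) - w θ)| := by
        rw [← poissonAvg_sub hr hr1 (by fun_prop) continuous_const, poissonAvg_const hr hr1,
          heatOp_eq_poissonAvg hp]
    _ ≤ poissonAvg (Real.exp (-t / 4)) (fun s => ε / 2 + A * (1 - Real.cos s)) :=
        abs_poissonAvg_le hr hr1 (by fun_prop) (hpt θ)
    _ = ε / 2 + A * poissonAvg (Real.exp (-t / 4)) (fun s => 1 - Real.cos s) := by
        rw [poissonAvg_add hr hr1 continuous_const (by fun_prop), poissonAvg_const hr hr1, hA1]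
    _ ≤ ε / 2 + A * ((1 - Real.exp (-t / 4) ^ 2) / (2 * Real.exp (-t / 4))) := by
        gcongr
        exact poissonAvg_one_sub_cos_le hr hr1
    _ ≤ ε := by linarith

end HeatOp

section HolderNorms

variable {γ : ℝ} {w : ℝ → ℝ}

lemma supN_nonneg (w : ℝ → ℝ) : 0 ≤ supN w :=
  Real.sSup_nonneg fun _ ⟨_, h⟩ => h ▸ norm_nonneg _

lemma hoSemi_nonneg (γ : ℝ) (w : ℝ → ℝ) : 0 ≤ hoSemi γ w :=
  Real.sSup_nonneg fun _ ⟨_, _, _, _, h⟩ => h ▸ by positivity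

lemma CkN_nonneg (k : ℕ) (w : ℝ → ℝ) : 0 ≤ CkN k w :=
  Finset.sum_nonneg fun _ _ => supN_nonneg _

lemma supN_le {C : ℝ} (hC : 0 ≤ C) (h : ∀ θ, |w θ| ≤ C) : supN w ≤ C :=
  Real.sSup_le (fun _ ⟨θ, hr⟩ => hr ▸ h θ) hC

lemma hoSemi_le {C : ℝ} (hC : 0 ≤ C)
    (h : ∀ θ θ', 0 < |θ - θ'| → |θ - θ'| < 1 → |w θ - w θ'| ≤ C * |θ - θ'| ^ γ) :
    hoSemi γ w ≤ C := by
  refine Real.sSup_le ?_ hC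
  rintro _ ⟨θ, θ', h0, h1, rfl⟩
  rw [div_le_iff₀ (Real.rpow_pos_of_pos h0 γ)]
  exact h θ θ' h0 h1

lemma abs_sub_le_hoSemi_mul {C : ℝ}
    (h : ∀ θ θ', 0 < |θ - θ'| → |θ - θ'| < 1 → |w θ - w θ'| ≤ C * |θ - θ'| ^ γ)
    {θ θ' : ℝ} (h0 : 0 < |θ - θ'|) (h1 : |θ - θ'| < 1) :
    |w θ - w θ'| ≤ hoSemi γ w * |θ - θ'| ^ γ := by
  rw [← div_le_iff₀ (Real.rpow_pos_of_pos h0 γ)]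
  refine le_csSup ⟨C, ?_⟩ ⟨θ, θ', h0, h1, rfl⟩
  rintro _ ⟨a, b, ha0, ha1, rfl⟩
  rw [div_le_iff₀ (Real.rpow_pos_of_pos ha0 γ)]
  exact h a b ha0 ha1

lemma tendsto_nhdsWithin_zero_of_nonneg_of_eventually_le {f : ℝ → ℝ} {s : Set ℝ} (hf : ∀ t, 0 ≤ f t)
    (h : ∀ ε, 0 < ε → ∀ᶠ t in nhdsWithin (0 : ℝ) s, f t ≤ ε) :
    Tendsto f (nhdsWithin 0 s) (nhds 0) := by
  refine Metric.tendsto_nhds.2 fun ε hε => ?_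
  filter_upwards [h _ (half_pos hε)] with t ht
  rw [Real.dist_eq, sub_zero, abs_of_nonneg (hf t)]
  linarith

end HolderNorms

section LittleHolder

variable {γ : ℝ} {w : ℝ → ℝ}

lemma tendsto_supN_heatOp_sub (hp : Function.Periodic w (2 * Real.pi)) (hw : Continuous w) :
    Tendsto (fun t => supN (fun θ => heatOp t w θ - w θ)) (nhdsWithin 0 (Set.Ioi 0)) (nhds 0) := by
  refine tendsto_nhdsWithin_zero_of_nonneg_of_eventually_le (fun t => supN_nonneg _) fun ε hε => ?_
  filter_upwards [eventually_abs_heatOp_sub_le hp hw hε] with t ht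
  exact supN_le hε.le ht

lemma tendsto_hoSemi_heatOp_sub (hγ : 0 < γ) (hp : Function.Periodic w (2 * Real.pi))
    (hw : Continuous w)
    (hl : ∀ ε : ℝ, 0 < ε → ∃ δ : ℝ, 0 < δ ∧ ∀ θ θ' : ℝ, 0 < |θ - θ'| → |θ - θ'| < δ →
      |w θ - w θ'| ≤ ε * |θ - θ'| ^ γ) :
    Tendsto (fun t => hoSemi γ (fun θ => heatOp t w θ - w θ))
      (nhdsWithin 0 (Set.Ioi 0)) (nhds 0) := by
  refine tendsto_nhdsWithin_zero_of_nonneg_of_eventually_le (fun t => hoSemi_nonneg _ _)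
    fun ε hε => ?_
  obtain ⟨δ, hδ, h⟩ := hl (ε / 2) (half_pos hε)
  have hδγ : 0 < δ ^ γ := Real.rpow_pos_of_pos hδ γ
  filter_upwards [eventually_abs_heatOp_sub_le hp hw (ε := ε * δ ^ γ / 2) (by positivity),
    self_mem_nhdsWithin] with t ht ht0
  refine hoSemi_le hε.le fun θ θ' h0 _ => ?_
  rcases lt_or_ge |θ - θ'| δ with hlt | hge
  · have h1 := h θ θ' h0 hlt
    have h2 : |heatOp t w θ - heatOp t w θ'| ≤ ε / 2 * |θ - θ'| ^ γ :=
      abs_heatOp_sub_heatOp_le ht0 hp hw fun s => by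
        have := h (θ - s) (θ' - s)
        rw [sub_sub_sub_cancel_right] at this
        exact this h0 hlt
    rw [sub_sub_sub_comm]
    linarith [abs_sub (heatOp t w θ - heatOp t w θ') (w θ - w θ')]
  · have h1 : ε * δ ^ γ ≤ ε * |θ - θ'| ^ γ := by gcongr
    linarith [abs_sub (heatOp t w θ - w θ) (heatOp t w θ' - w θ'), ht θ, ht θ']

lemma little_of_tendsto_hoSemi_heatOp_sub (hγ1 : γ < 1) (hp : Function.Periodic w (2 * Real.pi))
    (hw : Continuous w)
    (hC : ∃ C : ℝ, ∀ θ θ' : ℝ, 0 < |θ - θ'| → |θ - θ'| < 1 → |w θ - w θ'| ≤ C * |θ - θ'| ^ γ)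
    (hlim : Tendsto (fun t => hoSemi γ (fun θ => heatOp t w θ - w θ))
      (nhdsWithin 0 (Set.Ioi 0)) (nhds 0)) {ε : ℝ} (hε : 0 < ε) :
    ∃ δ : ℝ, 0 < δ ∧ ∀ θ θ' : ℝ, 0 < |θ - θ'| → |θ - θ'| < δ →
      |w θ - w θ'| ≤ ε * |θ - θ'| ^ γ := by
  obtain ⟨C, hC⟩ := hC
  obtain ⟨t, ht, ht0⟩ :=
    ((hlim.eventually (gt_mem_nhds (half_pos hε))).and self_mem_nhdsWithin).exists
  obtain ⟨L, hL, hlip⟩ := exists_lipschitz_heatOp ht0 hp hw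
  have hbd : ∀ θ θ', 0 < |θ - θ'| → |θ - θ'| < 1 →
      |(heatOp t w θ - w θ) - (heatOp t w θ' - w θ')| ≤ 2 * C * |θ - θ'| ^ γ := by
    intro θ θ' h0 h1
    have h2 : |heatOp t w θ - heatOp t w θ'| ≤ C * |θ - θ'| ^ γ :=
      abs_heatOp_sub_heatOp_le ht0 hp hw fun s => by
        have := hC (θ - s) (θ' - s)
        rw [sub_sub_sub_cancel_right] at this
        exact this h0 h1
    rw [sub_sub_sub_comm]
    linarith [abs_sub (heatOp t w θ - heatOp t w θ') (w θ - w θ'), hC θ θ' h0 h1]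
  have hpow : Tendsto (fun d : ℝ => L * d ^ (1 - γ)) (nhds 0) (nhds 0) := by
    have h := (Real.continuousAt_rpow_const 0 (1 - γ) (.inr (by linarith))).tendsto.const_mul L
    rwa [Real.zero_rpow (by linarith), mul_zero] at h
  obtain ⟨δ, hδ, hsmall⟩ := Metric.eventually_nhds_iff.1 (hpow.eventually (gt_mem_nhds (half_pos hε)))
  refine ⟨min δ 1, by positivity, fun θ θ' h0 hlt => ?_⟩
  obtain ⟨hlt, h1⟩ := lt_min_iff.1 hlt
  have hd := hsmall (y := |θ - θ'|) (by simpa [Real.dist_eq] using hlt)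
  have hγpos : 0 < |θ - θ'| ^ γ := Real.rpow_pos_of_pos h0 γ
  have hheat : |heatOp t w θ - heatOp t w θ'| ≤ ε / 2 * |θ - θ'| ^ γ := by
    calc _ ≤ L * |θ - θ'| := hlip θ θ'
      _ = L * |θ - θ'| ^ (1 - γ) * |θ - θ'| ^ γ := by
        rw [mul_assoc, ← Real.rpow_add h0, sub_add_cancel, Real.rpow_one]
      _ ≤ _ := by gcongr
  have hdiff : |(heatOp t w θ - w θ) - (heatOp t w θ' - w θ')| ≤ ε / 2 * |θ - θ'| ^ γ :=
    (abs_sub_le_hoSemi_mul (w := fun θ => heatOp t w θ - w θ) hbd h0 h1).trans (by gcongr)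
  calc |w θ - w θ'| = |(heatOp t w θ - heatOp t w θ') -
        ((heatOp t w θ - w θ) - (heatOp t w θ' - w θ'))| := by ring_nf
    _ ≤ _ := abs_sub _ _
    _ ≤ _ := by linarith

end LittleHolder

/-- Strong continuity of `e^{tΛ}` characterizes the little Hölder spaces
(Proposition 3.6 of Mori–Rodenberg–Spirn). -/
theorem stmt9 (k : ℕ) (γ : ℝ) (hγ0 : 0 < γ) (hγ1 : γ < 1) (u : ℝ → ℝ)
    (hu : MemHo k γ u) :
    Filter.Tendsto (fun t : ℝ => CkγN k γ (fun θ => heatOp t u θ - u θ))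
        (nhdsWithin 0 (Set.Ioi 0)) (nhds 0) ↔ MemLittle k γ u := by
  obtain ⟨hp, hcd, hC⟩ := id hu
  have hcont : ∀ l ≤ k, Continuous (iteratedDeriv l u) := fun l hl =>
    hcd.continuous_iteratedDeriv l (by exact_mod_cast hl)
  have hsemi : (fun t : ℝ => hoSemi γ (iteratedDeriv k (fun θ => heatOp t u θ - u θ)))
      =ᶠ[nhdsWithin 0 (Set.Ioi 0)]
      fun t => hoSemi γ (fun θ => heatOp t (iteratedDeriv k u) θ - iteratedDeriv k u θ) := by
    filter_upwards [self_mem_nhdsWithin] with t ht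
    rw [iteratedDeriv_heatOp_sub ht hp hcd le_rfl]
  constructor
  · intro h
    refine ⟨hu, fun ε hε => ?_⟩
    refine little_of_tendsto_hoSemi_heatOp_sub hγ1 (hp.iteratedDeriv k) (hcont k le_rfl) hC
      (Tendsto.congr' hsemi ?_) hε
    exact squeeze_zero (fun t => hoSemi_nonneg _ _)
      (fun t => le_add_of_nonneg_left (CkN_nonneg _ _)) h
  · rintro ⟨-, hl⟩
    have hsup : Tendsto (fun t : ℝ => CkN k (fun θ => heatOp t u θ - u θ))
        (nhdsWithin 0 (Set.Ioi 0)) (nhds (∑ _l ∈ Finset.range (k + 1), (0 : ℝ))) := by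
      refine tendsto_finsetSum _ fun l hlk => ?_
      have hlk : l ≤ k := Nat.lt_succ_iff.1 (Finset.mem_range.1 hlk)
      refine (tendsto_supN_heatOp_sub (hp.iteratedDeriv l) (hcont l hlk)).congr' ?_
      filter_upwards [self_mem_nhdsWithin] with t ht
      rw [iteratedDeriv_heatOp_sub ht hp hcd hlk]
    have hho := (tendsto_hoSemi_heatOp_sub hγ0 (hp.iteratedDeriv k) (hcont k le_rfl) hl).congr'
      hsemi.symm
    simpa [CkγN] using hsup.add hho
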